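/- Let a and c be integers with gcd(a,c) = 1 and c = r·q₁·q₂ for some positive integer r. Then S_{χ₁,χ₂}(a,c) = −(1/(r·q₁)) · ∑_{j=0}^{c−1} ∑_{n=0}^{q₁−1} conj(χ₂)(j) · conj(χ₁)(n) · ⌊j/q₂⌋ · ⌊aj/c + n/q₁⌋. -/

import Mathlib

open Complex Finset
open scoped Classical

/-- The sawtooth function `B₁(x)`: `0` if `x ∈ ℤ`, and `x - ⌊x⌋ - 1/2` otherwise. -/
noncomputable def sawtooth (x : ℝ) : ℝ :=
  if ∃ n : ℤ, (n : ℝ) = x then 0 else Int.fract x - 1 / 2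

/-- The newform Dedekind sum `S_{χ₁,χ₂}(a, c)` associated to Dirichlet characters
`χ₁ mod q₁` and `χ₂ mod q₂`. -/
noncomputable def newformDedekindSum {q₁ q₂ : ℕ} (χ₁ : DirichletCharacter ℂ q₁)
    (χ₂ : DirichletCharacter ℂ q₂) (a c : ℤ) : ℂ :=
  ∑ j ∈ Finset.range c.toNat, ∑ n ∈ Finset.range q₁,
    (starRingEnd ℂ) (χ₂ (j : ZMod q₂)) * (starRingEnd ℂ) (χ₁ (n : ZMod q₁)) *
      (sawtooth ((j : ℝ) / (c : ℝ)) : ℂ) *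
      (sawtooth ((n : ℝ) / (q₁ : ℝ) + (a : ℝ) * (j : ℝ) / (c : ℝ)) : ℂ)

/-- The newform Dedekind sum of a matrix `γ = (a, b; c, d) ∈ SL₂(ℤ)`:
it is `S_{χ₁,χ₂}(a, c)` if `c ≥ 1`, `S_{χ₁,χ₂}(-γ)` if `c ≤ -1`, and `0` if `c = 0`. -/
noncomputable def newformDedekindSumSL {q₁ q₂ : ℕ} (χ₁ : DirichletCharacter ℂ q₁)
    (χ₂ : DirichletCharacter ℂ q₂) (γ : Matrix.SpecialLinearGroup (Fin 2) ℤ) : ℂ :=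
  if γ.1 1 0 = 0 then 0
  else if 1 ≤ γ.1 1 0 then newformDedekindSum χ₁ χ₂ (γ.1 0 0) (γ.1 1 0)
  else newformDedekindSum χ₁ χ₂ (-(γ.1 0 0)) (-(γ.1 1 0))

/-- Membership in `Γ₀(N)`: the lower-left entry is divisible by `N`. -/
def InGamma0 (N : ℕ) (γ : Matrix.SpecialLinearGroup (Fin 2) ℤ) : Prop :=
  (N : ℤ) ∣ γ.1 1 0

/-- Membership in `Γ₁(N)`: lower-left entry divisible by `N` and both diagonal
entries congruent to `1` mod `N`. -/
def InGamma1 (N : ℕ) (γ : Matrix.SpecialLinearGroup (Fin 2) ℤ) : Prop :=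
  InGamma0 N γ ∧ (N : ℤ) ∣ (γ.1 0 0 - 1) ∧ (N : ℤ) ∣ (γ.1 1 1 - 1)

/-- `x` lies in the ring of integers `ℤ[χ₁,χ₂]` of the field `F_{χ₁,χ₂} ⊆ ℂ` generated
by the values of `χ₁` and `χ₂`: `x` lies in the subfield of `ℂ` generated by the values
of the characters and is integral over `ℤ`. -/
def InRingOfIntegers {q₁ q₂ : ℕ} (χ₁ : DirichletCharacter ℂ q₁)
    (χ₂ : DirichletCharacter ℂ q₂) (x : ℂ) : Prop :=
  x ∈ Subfield.closure (Set.range (χ₁ : ZMod q₁ → ℂ) ∪ Set.range (χ₂ : ZMod q₂ → ℂ)) ∧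
    IsIntegral ℤ x

/-- A sum over a full period is invariant under `m ↦ u * m + b` with `u` a unit mod `N`. -/
theorem sum_range_periodic_affine {M : Type*} [AddCommMonoid M] {N : ℕ} (hN : 0 < N)
    {f : ℤ → M} (hf : Function.Periodic f N) {u : ℤ} (hu : IsCoprime u (N : ℤ)) (b : ℤ) :
    ∑ m ∈ Finset.range N, f (u * m + b) = ∑ m ∈ Finset.range N, f m := by
  have hN' : (N : ℤ) ≠ 0 := by positivity
  have hmap : ∀ m ∈ Finset.range N, ((u * m + b) % N).toNat ∈ Finset.range N := by
    intro m _
    have h1 := Int.emod_nonneg (u * m + b) hN'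
    have h2 := Int.emod_lt_of_pos (u * m + b) (by positivity : (0 : ℤ) < N)
    rw [Finset.mem_range]
    omega
  have hinj : Set.InjOn (fun m : ℕ => ((u * m + b) % N).toNat) (Finset.range N) := by
    intro m hm m' hm' h
    have h1 := Int.emod_nonneg (u * m + b) hN'
    have h2 := Int.emod_nonneg (u * m' + b) hN'
    have h3 : (u * m + b) % N = (u * m' + b) % N := by
      dsimp only at h
      omega
    have h4 : (N : ℤ) ∣ u * (m' - m) := by
      have := Int.ModEq.dvd h3
      convert this using 1
      ring
    have h5 : (N : ℤ) ∣ m' - m := hu.symm.dvd_of_dvd_mul_left h4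
    have h6 : (m : ℤ) ≡ m' [ZMOD N] := (Int.modEq_iff_dvd).2 h5
    exact Nat.ModEq.eq_of_lt_of_lt ((Int.natCast_modEq_iff).1 h6)
      (Finset.mem_range.1 hm) (Finset.mem_range.1 hm')
  refine Finset.sum_nbij (fun m : ℕ => ((u * m + b) % N).toNat) hmap hinj
    (Finset.surjOn_of_injOn_of_card_le _ hmap hinj le_rfl) ?_
  intro m _
  have h1 := Int.emod_nonneg (u * m + b) hN'
  rw [Int.toNat_of_nonneg h1, Int.emod_def, mul_comm (N : ℤ), ← smul_eq_mul (a := _ / _),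
    hf.sub_zsmul_eq]

theorem sum_range_mul_eq {M : Type*} [AddCommMonoid M] (f : ℕ → M) (m n : ℕ) :
    ∑ j ∈ Finset.range (m * n), f j =
      ∑ k ∈ Finset.range n, ∑ i ∈ Finset.range m, f (k + n * i) := by
  rw [Finset.sum_comm]
  induction m with
  | zero => simp
  | succ m ih =>
    rw [Nat.succ_mul, Finset.sum_range_add, ih, Finset.sum_range_succ]
    simp [add_comm, mul_comm]

theorem sum_range_conj_dirichletCharacter {q : ℕ} (hq : 0 < q) {χ : DirichletCharacter ℂ q}
    (hχ : χ ≠ 1) : ∑ n ∈ Finset.range q, (starRingEnd ℂ) (χ (n : ZMod q)) = 0 := by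
  obtain ⟨q, rfl⟩ := Nat.exists_eq_succ_of_ne_zero hq.ne'
  rw [← map_sum, Finset.sum_range fun n : ℕ => χ (n : ZMod (q + 1))]
  have h := MulChar.sum_eq_zero_of_ne_one hχ
  have h' : ∑ i : Fin (q + 1), χ ((i : ℕ) : ZMod (q + 1)) = ∑ i : ZMod (q + 1), χ i :=
    Finset.sum_congr rfl fun i _ => congrArg χ (Fin.cast_val_eq_self i)
  simp only [Nat.succ_eq_add_one] at *
  rw [h', h, map_zero]

theorem sawtooth_of_not_int {x : ℝ} (hx : ¬ ∃ n : ℤ, (n : ℝ) = x) :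
    sawtooth x = Int.fract x - 1 / 2 :=
  if_neg hx

/-- The sum over `n < q` of `conj χ(n) * {a j / c + n / q}`, with `{x}` the fractional part. -/
noncomputable def twistedFractSum {q : ℕ} (χ : DirichletCharacter ℂ q) (a : ℤ) (c : ℕ)
    (j : ℕ) : ℂ :=
  ∑ n ∈ Finset.range q, (starRingEnd ℂ) (χ (n : ZMod q)) *
    (Int.fract ((a : ℝ) * j / c + (n : ℝ) / q) : ℝ)

theorem sum_twistedFractSum_eq_zero {q : ℕ} (hq : 0 < q) {χ : DirichletCharacter ℂ q}
    (hχ : χ ≠ 1) {a : ℤ} {r p : ℕ} (hr : 0 < r) (hp : 0 < p)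
    (hcop : IsCoprime a ((r * q : ℕ) : ℤ)) (k : ℕ) :
    ∑ m ∈ Finset.range (r * q), twistedFractSum χ a (r * q * p) (k + p * m) = 0 := by
  have hN : 0 < r * q := Nat.mul_pos hr hq
  have hr' : (r : ℝ) ≠ 0 := by positivity
  have hq' : (q : ℝ) ≠ 0 := by positivity
  have hp' : (p : ℝ) ≠ 0 := by positivity
  let f : ℤ → ℂ := fun u => (Int.fract ((a : ℝ) * k / (r * q * p : ℕ) + (u : ℝ) / (r * q)) : ℝ)
  have hf : Function.Periodic f (r * q : ℕ) := by
    intro u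
    have : (a : ℝ) * k / (r * q * p : ℕ) + ((u + (r * q : ℕ) : ℤ) : ℝ) / (r * q) =
        (a : ℝ) * k / (r * q * p : ℕ) + (u : ℝ) / (r * q) + 1 := by
      push_cast
      field_simp
      ring
    simp only [f]
    rw [this, Int.fract_add_one]
  unfold twistedFractSum
  rw [Finset.sum_comm]
  have key : ∀ n ∈ Finset.range q, ∑ m ∈ Finset.range (r * q),
      (starRingEnd ℂ) (χ (n : ZMod q)) *
        ((Int.fract ((a : ℝ) * (k + p * m : ℕ) / (r * q * p : ℕ) + (n : ℝ) / q) : ℝ) : ℂ) =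
      (starRingEnd ℂ) (χ (n : ZMod q)) * ∑ m ∈ Finset.range (r * q), f m := by
    intro n _
    rw [← sum_range_periodic_affine hN hf hcop (r * n), Finset.mul_sum]
    refine Finset.sum_congr rfl fun m _ => ?_
    simp only [f]
    congr 3
    push_cast
    field_simp
    ring
  rw [Finset.sum_congr rfl key, ← Finset.sum_mul, sum_range_conj_dirichletCharacter hq hχ,
    zero_mul]

theorem not_int_div_add {q : ℕ} (hq : 0 < q) {a : ℤ} {r p : ℕ} (hr : 0 < r) (hp : 0 < p)
    (hcop : IsCoprime a (p : ℤ)) {j : ℕ} (hj : ¬ p ∣ j) (n : ℕ) :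
    ¬ ∃ z : ℤ, (z : ℝ) = (n : ℝ) / q + (a : ℝ) * j / (r * q * p : ℕ) := by
  rintro ⟨z, hz⟩
  have hr' : (r : ℝ) ≠ 0 := by positivity
  have hq' : (q : ℝ) ≠ 0 := by positivity
  have hp' : (p : ℝ) ≠ 0 := by positivity
  push_cast at hz
  field_simp at hz
  have h : a * j = p * (z * (r * q) - n * r) := by
    have : (a * j : ℝ) = p * (z * (r * q) - n * r) := by linear_combination -hz
    exact_mod_cast this
  exact hj (Int.natCast_dvd_natCast.1 (hcop.symm.dvd_of_dvd_mul_left ⟨_, h⟩))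

theorem not_int_div {r p : ℕ} (hr : 0 < r) (hp : 0 < p) {j : ℕ} (hj : ¬ p ∣ j) :
    ¬ ∃ z : ℤ, (z : ℝ) = (j : ℝ) / (r * p : ℕ) := by
  have h := not_int_div_add (q := 1) one_pos hr hp (isCoprime_one_left (x := (p : ℤ))) hj 0
  simpa using h

theorem dirichletCharacter_natCast_eq_zero {q : ℕ} (hq : 0 < q) {χ : DirichletCharacter ℂ q}
    (hχ : χ ≠ 1) {j : ℕ} (hj : q ∣ j) : χ (j : ZMod q) = 0 := by
  have : (j : ZMod q) = 0 := (ZMod.natCast_eq_zero_iff _ _).2 hj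
  rw [this]
  apply MulChar.map_nonunit
  intro h
  have hq1 : q ≠ 1 := by
    rintro rfl
    exact hχ (DirichletCharacter.level_one χ)
  have : Fact (1 < q) := ⟨by omega⟩
  exact not_isUnit_zero h

theorem sum_sawtooth_eq {q p : ℕ} (hq : 0 < q) (hp : 0 < p) {χ₁ : DirichletCharacter ℂ q}
    {χ₂ : DirichletCharacter ℂ p} (hχ₁ : χ₁ ≠ 1) (hχ₂ : χ₂ ≠ 1) {a : ℤ} {r : ℕ} (hr : 0 < r)
    (hcop : IsCoprime a (p : ℤ)) {j : ℕ} (hj : j < r * q * p) :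
    ∑ n ∈ Finset.range q,
      (starRingEnd ℂ) (χ₂ (j : ZMod p)) * (starRingEnd ℂ) (χ₁ (n : ZMod q)) *
        (sawtooth ((j : ℝ) / (r * q * p : ℕ)) : ℂ) *
        (sawtooth ((n : ℝ) / q + (a : ℝ) * j / (r * q * p : ℕ)) : ℂ) =
      (starRingEnd ℂ) (χ₂ (j : ZMod p)) * ((j : ℂ) / (r * q * p) - 1 / 2) *
        twistedFractSum χ₁ a (r * q * p) j := by
  by_cases hpj : p ∣ j
  · simp [dirichletCharacter_natCast_eq_zero hp hχ₂ hpj]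
  have hfr : Int.fract ((j : ℝ) / (r * q * p : ℕ)) = (j : ℝ) / (r * q * p : ℕ) := by
    have hc : (0 : ℝ) < (r * q * p : ℕ) := by exact_mod_cast (by omega)
    rw [Int.fract_eq_self]
    exact ⟨by positivity, (div_lt_one hc).2 (by exact_mod_cast hj)⟩
  rw [sawtooth_of_not_int (not_int_div (Nat.mul_pos hr hq) hp hpj), hfr, twistedFractSum,
    Finset.mul_sum, ← sub_eq_zero, ← Finset.sum_sub_distrib]
  trans ∑ n ∈ Finset.range q, (starRingEnd ℂ) (χ₁ (n : ZMod q)) *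
    (-(starRingEnd ℂ) (χ₂ (j : ZMod p)) * ((j : ℂ) / (r * q * p) - 1 / 2) / 2)
  · refine Finset.sum_congr rfl fun n _ => ?_
    rw [sawtooth_of_not_int (not_int_div_add hq hr hp hcop hpj n),
      add_comm ((n : ℝ) / q)]
    push_cast
    ring
  · rw [← Finset.sum_mul, sum_range_conj_dirichletCharacter hq hχ₁, zero_mul]

theorem sum_floor_eq {q : ℕ} (hq : 0 < q) {χ : DirichletCharacter ℂ q} (hχ : χ ≠ 1) (a : ℤ)
    (c p j : ℕ) (w : ℂ) :
    ∑ n ∈ Finset.range q, w * (starRingEnd ℂ) (χ (n : ZMod q)) *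
        ((⌊(j : ℝ) / (p : ℝ)⌋ : ℤ) : ℂ) *
        ((⌊(a : ℝ) * j / c + (n : ℝ) / q⌋ : ℤ) : ℂ) =
      w * ((j / p : ℕ) : ℂ) *
        (∑ n ∈ Finset.range q, (starRingEnd ℂ) (χ (n : ZMod q)) * ((n : ℂ) / q) -
          twistedFractSum χ a c j) := by
  have hfl : ⌊(j : ℝ) / (p : ℝ)⌋ = ((j / p : ℕ) : ℤ) := by
    rw [← Nat.floor_div_eq_div (K := ℝ), Int.natCast_floor_eq_floor (by positivity)]
  rw [twistedFractSum, ← Finset.sum_sub_distrib, Finset.mul_sum, ← sub_eq_zero,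
    ← Finset.sum_sub_distrib]
  trans ∑ n ∈ Finset.range q, (starRingEnd ℂ) (χ (n : ZMod q)) *
    (w * ((j / p : ℕ) : ℂ) * ((a : ℂ) * j / c))
  · refine Finset.sum_congr rfl fun n _ => ?_
    rw [hfl, Int.cast_natCast, ← Int.self_sub_floor]
    push_cast
    ring
  · rw [← Finset.sum_mul, sum_range_conj_dirichletCharacter hq hχ, zero_mul]

theorem newform_dedekind_sum_floor_formula {q₁ q₂ : ℕ} (hq₁ : 0 < q₁) (hq₂ : 0 < q₂)
    (χ₁ : DirichletCharacter ℂ q₁) (χ₂ : DirichletCharacter ℂ q₂)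
    (hχ₁ : χ₁ ≠ 1) (hχ₂ : χ₂ ≠ 1) (hp₁ : χ₁.IsPrimitive) (hp₂ : χ₂.IsPrimitive)
    (hpar : χ₁ (-1) * χ₂ (-1) = 1)
    (a c r : ℤ) (hr : 0 < r) (hc : c = r * ((q₁ : ℤ) * (q₂ : ℤ))) (hcop : IsCoprime a c) :
    newformDedekindSum χ₁ χ₂ a c =
      -(1 / ((r : ℂ) * (q₁ : ℂ))) * ∑ j ∈ Finset.range c.toNat, ∑ n ∈ Finset.range q₁,
        (starRingEnd ℂ) (χ₂ (j : ZMod q₂)) * (starRingEnd ℂ) (χ₁ (n : ZMod q₁)) *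
          ((⌊(j : ℝ) / (q₂ : ℝ)⌋ : ℤ) : ℂ) *
          ((⌊(a : ℝ) * (j : ℝ) / (c : ℝ) + (n : ℝ) / (q₁ : ℝ)⌋ : ℤ) : ℂ) := by
  lift r to ℕ using hr.le
  have hr' : 0 < r := by exact_mod_cast hr
  obtain rfl : c = ((r * q₁ * q₂ : ℕ) : ℤ) := by
    rw [hc]
    push_cast
    ring
  have hcop₁ : IsCoprime a ((r * q₁ : ℕ) : ℤ) :=
    hcop.of_isCoprime_of_dvd_right ⟨q₂, by push_cast; ring⟩
  have hcop₂ : IsCoprime a (q₂ : ℤ) :=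
    hcop.of_isCoprime_of_dvd_right ⟨r * q₁, by push_cast; ring⟩
  have hrC : (r : ℂ) ≠ 0 := by exact_mod_cast hr'.ne'
  have hq₁C : (q₁ : ℂ) ≠ 0 := by exact_mod_cast hq₁.ne'
  have hq₂C : (q₂ : ℂ) ≠ 0 := by exact_mod_cast hq₂.ne'
  unfold newformDedekindSum
  simp only [Int.toNat_natCast, Int.cast_natCast]
  rw [Finset.sum_congr rfl fun j hj =>
      sum_sawtooth_eq hq₁ hq₂ hχ₁ hχ₂ hr' hcop₂ (Finset.mem_range.1 hj),
    Finset.sum_congr rfl fun j _ => sum_floor_eq hq₁ hχ₁ a (r * q₁ * q₂) q₂ j _]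
  set B := ∑ n ∈ Finset.range q₁, (starRingEnd ℂ) (χ₁ (n : ZMod q₁)) * ((n : ℂ) / q₁)
  set F := twistedFractSum χ₁ a (r * q₁ * q₂)
  rw [sum_range_mul_eq, sum_range_mul_eq, Finset.mul_sum, ← sub_eq_zero,
    ← Finset.sum_sub_distrib]
  trans ∑ k ∈ Finset.range q₂, (starRingEnd ℂ) (χ₂ (k : ZMod q₂)) *
    (1 / (r * q₁) * B * ∑ m ∈ Finset.range (r * q₁), (m : ℂ))
  · refine Finset.sum_congr rfl fun k hk => ?_
    have hF0 : ∑ m ∈ Finset.range (r * q₁), F (k + q₂ * m) = 0 :=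
      sum_twistedFractSum_eq_zero hq₁ hχ₁ hr' hq₂ hcop₁ k
    rw [← sub_eq_zero, Finset.mul_sum, Finset.mul_sum, Finset.mul_sum,
      ← Finset.sum_sub_distrib, ← Finset.sum_sub_distrib]
    trans ∑ m ∈ Finset.range (r * q₁), (starRingEnd ℂ) (χ₂ (k : ZMod q₂)) *
      ((k : ℂ) / (r * q₁ * q₂) - 1 / 2) * F (k + q₂ * m)
    · refine Finset.sum_congr rfl fun m _ => ?_
      have hdiv : (k + q₂ * m) / q₂ = m := by
        rw [Nat.add_mul_div_left _ _ hq₂, Nat.div_eq_of_lt (Finset.mem_range.1 hk), zero_add]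
      rw [hdiv]
      push_cast
      rw [ZMod.natCast_self, zero_mul, add_zero]
      field_simp
      ring
    · rw [← Finset.mul_sum, hF0, mul_zero]
  · rw [← Finset.sum_mul, sum_range_conj_dirichletCharacter hq₂ hχ₂, zero_mul]
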